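/- The 436 × 436 matrix GS([B1], [B2], [B3], [B4]) built by substituting the circulant matrices [B1], [B2], [B3], [B4] into the Goethals–Seidel array is a skew-Hadamard matrix of order 436; that is, all its entries are ±1, it satisfies M · Mᵀ = 436 · I_436, and M + Mᵀ = 2 · I_436. -/

import Mathlib

open Finset Matrix

/-- The subgroup H of order 3 of the multiplicative group of `ZMod 109`. -/
def H : Finset (ZMod 109) := {1, 45, 63}

/-- Representatives of the even-indexed orbits. -/
def rep : List (ZMod 109) := [1, 2, 3, 4, 5, 6, 8, 9, 10, 11, 13, 15, 16, 18, 20, 23, 25, 30]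

/-- The orbits `α i`: `α (2*i) = rep[i] • H` and `α (2*i+1) = -α (2*i)`. -/
def alpha (i : ℕ) : Finset (ZMod 109) :=
  if i % 2 = 0 then H.image (fun h => rep.getD (i / 2) 0 * h)
  else (H.image (fun h => rep.getD (i / 2) 0 * h)).image (fun x => -x)

def B1 : Finset (ZMod 109) := ({0, 3, 5, 6, 9, 10, 13, 15, 16, 18, 21, 23, 24, 27, 28, 30, 32, 34} : Finset ℕ).biUnion alpha
def B2 : Finset (ZMod 109) := ({1, 4, 5, 6, 7, 8, 10, 11, 12, 13, 16, 19, 20, 21, 25, 27, 30, 31, 34} : Finset ℕ).biUnion alpha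
def B3 : Finset (ZMod 109) := ({0, 1, 2, 3, 4, 6, 10, 12, 13, 15, 16, 17, 20, 22, 23, 24, 25, 29, 34, 35} : Finset ℕ).biUnion alpha
def B4 : Finset (ZMod 109) := ({0, 1, 2, 3, 5, 8, 9, 12, 13, 14, 15, 16, 19, 21, 23, 25, 26, 28, 29, 33, 34} : Finset ℕ).biUnion alpha

/-- The circulant {±1}-matrix `[X]` associated to `X ⊆ ZMod 109`. -/
def circ (X : Finset (ZMod 109)) : Matrix (ZMod 109) (ZMod 109) ℤ :=
  Matrix.of fun i j => if j - i ∈ X then -1 else 1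

/-- The back-diagonal permutation matrix `R`. -/
def R : Matrix (ZMod 109) (ZMod 109) ℤ :=
  Matrix.of fun i j => if i + j = (108 : ZMod 109) then 1 else 0

/-- The Goethals–Seidel array. -/
def GS (P1 P2 P3 P4 : Matrix (ZMod 109) (ZMod 109) ℤ) :
    Matrix (Fin 4 × ZMod 109) (Fin 4 × ZMod 109) ℤ :=
  Matrix.of fun p q =>
    (![![P1, P2 * R, P3 * R, P4 * R],
       ![-(P2 * R), P1, -(P4ᵀ * R), P3ᵀ * R],
       ![-(P3 * R), P4ᵀ * R, P1, -(P2ᵀ * R)],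
       ![-(P4 * R), -(P3ᵀ * R), P2ᵀ * R, P1]] p.1 q.1) p.2 q.2

/-- The first row of `circ X`. -/
def circRow (X : Finset (ZMod 109)) (d : ZMod 109) : ℤ := if d ∈ X then -1 else 1

/-- The `±1`-sequence whose `-1`s are at the positions of the binary digits `1` of `N`. -/
def bitSign (N : ℕ) (d : ZMod 109) : ℤ := bif N.testBit d.val then -1 else 1

theorem circRow_B1 : ∀ d, circRow B1 d = bitSign 272651854555632155614714051255378 d := by
  decide +kernel

theorem circRow_B2 : ∀ d, circRow B2 d = bitSign 459456625862466354461078265554424 d := by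
  decide +kernel

theorem circRow_B3 : ∀ d, circRow B3 d = bitSign 491291252973569955345216406545758 d := by
  decide +kernel

theorem circRow_B4 : ∀ d, circRow B4 d = bitSign 597655088655946324782822385932198 d := by
  decide +kernel

theorem circRow_B1_skew : ∀ d, circRow B1 d + circRow B1 (-d) = if d = 0 then 2 else 0 := by
  simp only [circRow_B1]
  decide +kernel

theorem sum_autocorrelation : ∀ d, ∑ x, (circRow B1 x * circRow B1 (x + d)
    + circRow B2 x * circRow B2 (x + d) + circRow B3 x * circRow B3 (x + d)
    + circRow B4 x * circRow B4 (x + d)) = if d = 0 then 436 else 0 := by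
  simp only [circRow_B1, circRow_B2, circRow_B3, circRow_B4]
  decide +kernel

theorem circ_apply (X : Finset (ZMod 109)) (i j : ZMod 109) : circ X i j = circRow X (j - i) := rfl

theorem circ_eq_circulant (X : Finset (ZMod 109)) :
    circ X = circulant fun d => circRow X (-d) := by
  ext i j
  simp [circ_apply]

theorem circ_mul_comm (X Y : Finset (ZMod 109)) : circ X * circ Y = circ Y * circ X := by
  simp only [circ_eq_circulant, circulant_mul_comm]

theorem circ_transpose_mul_comm (X Y : Finset (ZMod 109)) :
    (circ X)ᵀ * circ Y = circ Y * (circ X)ᵀ := by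
  simp only [circ_eq_circulant, transpose_circulant]
  exact circulant_mul_comm _ _

theorem isUnit_circ_apply (X : Finset (ZMod 109)) (i j : ZMod 109) : IsUnit (circ X i j) := by
  rw [circ_apply, circRow]
  split_ifs <;> simp

theorem circ_B1_add_transpose : circ B1 + (circ B1)ᵀ = (2 : ℤ) • 1 := by
  ext i j
  have h := circRow_B1_skew (j - i)
  rw [neg_sub] at h
  simpa [circ_apply, one_apply, sub_eq_zero, eq_comm (a := j)] using h

theorem sum_circ_mul_transpose :
    circ B1 * (circ B1)ᵀ + circ B2 * (circ B2)ᵀ + circ B3 * (circ B3)ᵀ + circ B4 * (circ B4)ᵀ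
      = (436 : ℤ) • 1 := by
  ext i j
  have h := sum_autocorrelation (i - j)
  rw [← Equiv.sum_comp (Equiv.subRight i)] at h
  simpa [circ_apply, mul_apply, one_apply, sub_eq_zero, Finset.sum_add_distrib] using h

theorem mul_R_apply (P : Matrix (ZMod 109) (ZMod 109) ℤ) (i j : ZMod 109) :
    (P * R) i j = P i (108 - j) := by
  simp [mul_apply, R, ← eq_sub_iff_add_eq]

theorem R_transpose : Rᵀ = R := by
  ext i j
  simp [R, add_comm]

theorem R_mul_R : R * R = 1 := by
  ext i j
  rw [mul_R_apply]
  simp [R, one_apply, ← add_sub_assoc, sub_eq_iff_eq_add, add_comm (108 : ZMod 109)]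

theorem circ_mul_R_transpose (X : Finset (ZMod 109)) : (circ X * R)ᵀ = circ X * R := by
  ext i j
  simp only [transpose_apply, mul_R_apply, circ_apply]
  congr 1
  ring

theorem R_mul_circ_transpose (X : Finset (ZMod 109)) : R * (circ X)ᵀ = circ X * R := by
  rw [← circ_mul_R_transpose, transpose_mul, R_transpose]

theorem R_mul_circ (X : Finset (ZMod 109)) : R * circ X = (circ X)ᵀ * R := by
  rw [← Matrix.mul_one (R * circ X), ← R_mul_R, ← Matrix.mul_assoc, Matrix.mul_assoc R,
    ← R_mul_circ_transpose, ← Matrix.mul_assoc R R, R_mul_R, Matrix.one_mul]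

/-- The blocks of the Goethals–Seidel array. -/
def gsBlock (P1 P2 P3 P4 : Matrix (ZMod 109) (ZMod 109) ℤ) :
    Fin 4 → Fin 4 → Matrix (ZMod 109) (ZMod 109) ℤ :=
  ![![P1, P2 * R, P3 * R, P4 * R],
    ![-(P2 * R), P1, -(P4ᵀ * R), P3ᵀ * R],
    ![-(P3 * R), P4ᵀ * R, P1, -(P2ᵀ * R)],
    ![-(P4 * R), -(P3ᵀ * R), P2ᵀ * R, P1]]

theorem GS_apply (P1 P2 P3 P4 : Matrix (ZMod 109) (ZMod 109) ℤ) (p q : Fin 4 × ZMod 109) :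
    GS P1 P2 P3 P4 p q = gsBlock P1 P2 P3 P4 p.1 q.1 p.2 q.2 := rfl

theorem isUnit_GS_circ_apply (X Y Z W : Finset (ZMod 109)) (p q : Fin 4 × ZMod 109) :
    IsUnit (GS (circ X) (circ Y) (circ Z) (circ W) p q) := by
  obtain ⟨a, i⟩ := p
  obtain ⟨b, j⟩ := q
  rw [GS_apply]
  generalize hM : gsBlock (circ X) (circ Y) (circ Z) (circ W) a b = M
  fin_cases a <;> fin_cases b <;> simp [gsBlock] at hM <;> subst hM <;>
    simp [mul_R_apply, isUnit_circ_apply]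

theorem gsBlock_circ_mul_transpose (X Y Z W : Finset (ZMod 109)) (a b : Fin 4) :
    ∑ c, gsBlock (circ X) (circ Y) (circ Z) (circ W) a c *
        (gsBlock (circ X) (circ Y) (circ Z) (circ W) b c)ᵀ =
      if a = b then circ X * (circ X)ᵀ + circ Y * (circ Y)ᵀ + circ Z * (circ Z)ᵀ
        + circ W * (circ W)ᵀ else 0 := by
  have hR (S : Finset (ZMod 109)) (P : Matrix (ZMod 109) (ZMod 109) ℤ) :
      R * (circ S * P) = (circ S)ᵀ * (R * P) := by
    simp only [← Matrix.mul_assoc, R_mul_circ]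
  have hR' (S : Finset (ZMod 109)) (P : Matrix (ZMod 109) (ZMod 109) ℤ) :
      R * ((circ S)ᵀ * P) = circ S * (R * P) := by
    simp only [← Matrix.mul_assoc, R_mul_circ_transpose]
  have hc (S T : Finset (ZMod 109)) (P : Matrix (ZMod 109) (ZMod 109) ℤ) :
      circ S * (circ T * P) = circ T * (circ S * P) := by
    simp only [← Matrix.mul_assoc, circ_mul_comm S T]
  have hc' (S T : Finset (ZMod 109)) (P : Matrix (ZMod 109) (ZMod 109) ℤ) :
      (circ S)ᵀ * (circ T * P) = circ T * ((circ S)ᵀ * P) := by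
    simp only [← Matrix.mul_assoc, circ_transpose_mul_comm]
  have ht (S T : Finset (ZMod 109)) : (circ S)ᵀ * (circ T)ᵀ = (circ T)ᵀ * (circ S)ᵀ := by
    rw [← transpose_mul, circ_mul_comm, transpose_mul]
  fin_cases a <;> fin_cases b <;>
    simp [gsBlock, Fin.sum_univ_four, Matrix.mul_assoc, R_transpose, R_mul_R, R_mul_circ_transpose,
      R_mul_circ, hR, hR', circ_transpose_mul_comm, circ_mul_comm, hc, hc', ht] <;>
    abel

theorem gsBlock_circ_B_add_transpose (Y Z W : Finset (ZMod 109)) (a b : Fin 4) :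
    gsBlock (circ B1) (circ Y) (circ Z) (circ W) a b +
      (gsBlock (circ B1) (circ Y) (circ Z) (circ W) b a)ᵀ =
      if a = b then (2 : ℤ) • 1 else 0 := by
  fin_cases a <;> fin_cases b <;>
    simp [gsBlock, R_transpose, R_mul_circ_transpose, R_mul_circ] <;>
    simpa using circ_B1_add_transpose

theorem gs_skew_hadamard_B :
    (∀ p q, GS (circ B1) (circ B2) (circ B3) (circ B4) p q = 1 ∨
            GS (circ B1) (circ B2) (circ B3) (circ B4) p q = -1) ∧
    GS (circ B1) (circ B2) (circ B3) (circ B4) *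
      (GS (circ B1) (circ B2) (circ B3) (circ B4))ᵀ = (436 : ℤ) • 1 ∧
    GS (circ B1) (circ B2) (circ B3) (circ B4) +
      (GS (circ B1) (circ B2) (circ B3) (circ B4))ᵀ = (2 : ℤ) • 1 := by
  refine ⟨fun p q => Int.isUnit_iff.1 (isUnit_GS_circ_apply _ _ _ _ p q), ?_, ?_⟩
  · ext ⟨a, i⟩ ⟨b, j⟩
    have h := congrFun₂ (gsBlock_circ_mul_transpose B1 B2 B3 B4 a b) i j
    rw [sum_circ_mul_transpose, Matrix.sum_apply] at h
    rw [mul_apply, Fintype.sum_prod_type]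
    refine h.trans ?_
    by_cases hab : a = b <;> simp [hab, one_apply]
  · ext ⟨a, i⟩ ⟨b, j⟩
    refine (congrFun₂ (gsBlock_circ_B_add_transpose B2 B3 B4 a b) i j).trans ?_
    by_cases hab : a = b <;> simp [hab, one_apply]
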